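/- arXiv:2408.08520 — 5 statements merged into one kernel-verified Lean document; each statement's English description precedes it below -/
import Mathlib

section
/- Let X be an L-convex space and for each convex set A define φ(A) : cp(C(X)) → L by φ(A)(K) = sub(K,A) on the set cp(C(X)) of compact convex sets of X. Then sub_X(A, B) = sub_{cp(C(X))}(φ(A), φ(B)) for all convex sets A, B of X. -/
universe u v w u'

/-- A complete residuated lattice: a complete lattice with a commutative monoid
operation `tens` whose unit is the top element and which distributes over
arbitrary joins; `himp` is its residuation. -/
class CRL (L : Type u) extends CompleteLattice L where
  tens : L → L → L
  himp : L → L → L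
  tens_comm : ∀ a b : L, tens a b = tens b a
  tens_assoc : ∀ a b c : L, tens (tens a b) c = tens a (tens b c)
  tens_top : ∀ a : L, tens a ⊤ = a
  tens_sSup : ∀ (a : L) (S : Set L), tens a (sSup S) = ⨆ b ∈ S, tens a b
  tens_le_iff_le_himp : ∀ a b c : L, tens a b ≤ c ↔ a ≤ himp b c

namespace CRL

variable {L : Type u} [CRL L]

lemma le_himp_iff {a b c : L} : a ≤ himp b c ↔ tens a b ≤ c :=
  (tens_le_iff_le_himp a b c).symm

lemma tens_himp_le (b c : L) : tens (himp b c) b ≤ c := le_himp_iff.mp le_rfl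

lemma tens_mono_right (a : L) {b c : L} (h : b ≤ c) : tens a b ≤ tens a c := by
  have h1 : sSup ({b, c} : Set L) = c := by
    apply le_antisymm (sSup_le ?_) (le_sSup (by simp))
    rintro x (rfl | rfl)
    · exact h
    · exact le_rfl
  have h2 : tens a b ≤ ⨆ x ∈ ({b, c} : Set L), tens a x :=
    le_biSup _ (by simp)
  calc tens a b ≤ ⨆ x ∈ ({b, c} : Set L), tens a x := h2
    _ = tens a (sSup {b, c}) := (tens_sSup a _).symm
    _ = tens a c := by rw [h1]

lemma tens_mono_left {a b : L} (c : L) (h : a ≤ b) : tens a c ≤ tens b c := by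
  rw [tens_comm a c, tens_comm b c]; exact tens_mono_right c h

lemma himp_le_himp_right (a : L) {b c : L} (h : b ≤ c) : himp a b ≤ himp a c :=
  le_himp_iff.mpr (le_trans (tens_himp_le a b) h)

lemma himp_le_himp_left {a b : L} (c : L) (h : a ≤ b) : himp b c ≤ himp a c :=
  le_himp_iff.mpr (le_trans (tens_mono_right _ h) (tens_himp_le b c))

lemma tens_bot (a : L) : tens a ⊥ = ⊥ := by
  have := tens_sSup a ∅
  simpa using this

lemma top_himp (a : L) : himp ⊤ a = a := by
  apply le_antisymm
  · have := tens_himp_le (⊤ : L) a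
    rwa [tens_top] at this
  · exact le_himp_iff.mpr (by rw [tens_top])

lemma bot_himp (a : L) : himp ⊥ a = ⊤ :=
  le_antisymm le_top (le_himp_iff.mpr (by rw [tens_bot]; exact bot_le))

lemma tens_iSup {ι : Sort w} (a : L) (f : ι → L) :
    tens a (⨆ i, f i) = ⨆ i, tens a (f i) := by
  rw [iSup, tens_sSup, iSup_range]

lemma himp_iSup_left {ι : Sort w} (f : ι → L) (c : L) :
    himp (⨆ i, f i) c = ⨅ i, himp (f i) c := by
  apply le_antisymm
  · exact le_iInf fun i => himp_le_himp_left c (le_iSup f i)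
  · apply le_himp_iff.mpr
    rw [tens_iSup]
    apply iSup_le
    intro i
    exact le_trans (tens_mono_left _ (iInf_le _ i)) (tens_himp_le _ _)

/-! ### L-subsets -/

/-- The fuzzy inclusion order on `L`-subsets. -/
def fsub {X : Type v} (A B : X → L) : L := ⨅ x, himp (A x) (B x)

/-- A nonempty `L`-subset. -/
def NonemptyL {X : Type v} (A : X → L) : Prop := (⨆ x, A x) = ⊤

/-- A finite `L`-subset. -/
def FinL {X : Type v} (F : X → L) : Prop :=
  ∀ D : Set (X → L), D.Nonempty → DirectedOn (· ≤ ·) D →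
    fsub F (sSup D) = ⨆ A ∈ D, fsub F A

open Classical in
/-- Characteristic function of a crisp subset. -/
noncomputable def chi {X : Type v} (Z : Set X) : X → L :=
  fun x => if x ∈ Z then ⊤ else ⊥

/-- Characteristic function of a point. -/
noncomputable def single {X : Type v} (x : X) : X → L := chi {x}

/-! ### L-convex structures -/

/-- A (stratified) `L`-convex structure on `X`. -/
def IsConvexStruct {X : Type v} (𝒞 : Set (X → L)) : Prop :=
  (fun _ => (⊥ : L)) ∈ 𝒞 ∧ (fun _ => (⊤ : L)) ∈ 𝒞 ∧
  (∀ D ⊆ 𝒞, D.Nonempty → DirectedOn (· ≤ ·) D → sSup D ∈ 𝒞) ∧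
  (∀ D ⊆ 𝒞, sInf D ∈ 𝒞) ∧
  (∀ (a : L), ∀ C ∈ 𝒞, (fun x => himp a (C x)) ∈ 𝒞)

/-- The hull operator of an `L`-convex structure. -/
def hull {X : Type v} (𝒞 : Set (X → L)) (A : X → L) : X → L :=
  sInf {B | B ∈ 𝒞 ∧ A ≤ B}

/-- Sobriety of an `L`-convex space. -/
def Sober {X : Type v} (𝒞 : Set (X → L)) : Prop :=
  ∀ F : X → L, NonemptyL F → FinL F → ∃! x : X, hull 𝒞 F = hull 𝒞 (single x)

/-- Compact (algebraic irreducible) convex sets. -/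
def IsCompactConvex {X : Type v} (𝒞 : Set (X → L)) (K : X → L) : Prop :=
  K ∈ 𝒞 ∧ NonemptyL K ∧
  ∀ D ⊆ 𝒞, D.Nonempty → DirectedOn (· ≤ ·) D →
    fsub K (sSup D) = ⨆ C ∈ D, fsub K C

/-- Convexity-preserving maps. -/
def ConvPres {X : Type v} {Y : Type w} (𝒞X : Set (X → L)) (𝒞Y : Set (Y → L))
    (f : X → Y) : Prop :=
  ∀ B ∈ 𝒞Y, (B ∘ f) ∈ 𝒞X

/-- The Zadeh (forward) extension of a map. -/
def zimg {X : Type v} {Y : Type w} (f : X → Y) (A : X → L) : Y → L :=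
  fun y => ⨆ x ∈ {x | f x = y}, A x

/-- Convex-to-convex maps. -/
def ConvToConv {X : Type v} {Y : Type w} (𝒞X : Set (X → L)) (𝒞Y : Set (Y → L))
    (f : X → Y) : Prop :=
  ∀ A ∈ 𝒞X, zimg f A ∈ 𝒞Y

/-- F-closed crisp subsets of an `L`-convex space. -/
def FClosed {X : Type v} (𝒞 : Set (X → L)) (A : Set X) : Prop :=
  ∀ F : X → L, NonemptyL F → FinL F → F ≤ chi A →
    ∀ x : X, hull 𝒞 F = hull 𝒞 (single x) → x ∈ A

/-- F-closure of a crisp subset. -/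
def fcl {X : Type v} (𝒞 : Set (X → L)) (Z : Set X) : Set X :=
  ⋂₀ {A : Set X | FClosed 𝒞 A ∧ Z ⊆ A}

/-- The `S₀` separation axiom. -/
def S0 {X : Type v} (𝒞 : Set (X → L)) : Prop :=
  ∀ x y : X, hull 𝒞 (single x) = hull 𝒞 (single y) → x = y

/-- The set of compact convex sets, as a type. -/
abbrev cpT {X : Type v} (𝒞 : Set (X → L)) : Type _ :=
  {K : X → L // IsCompactConvex 𝒞 K}

/-- `φ(A)(K) = sub(K, A)`. -/
def phi {X : Type v} (𝒞 : Set (X → L)) (A : X → L) : cpT 𝒞 → L :=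
  fun K => fsub K.1 A

/-- The convex structure `{φ(A) | A ∈ 𝒞}` on `cp(𝒞)`. -/
def cpStruct {X : Type v} (𝒞 : Set (X → L)) : Set (cpT 𝒞 → L) :=
  {Φ | ∃ A ∈ 𝒞, Φ = phi 𝒞 A}

/-- `Θ(X) = {co(1ₓ) | x ∈ X}` as a subset of `cp(𝒞)`. -/
def Theta {X : Type v} (𝒞 : Set (X → L)) : Set (cpT 𝒞) :=
  {K | ∃ x : X, (K : X → L) = hull 𝒞 (single x)}

/-- `X^F`: the F-closure of `Θ(X)` in `Cp(𝒞)`. -/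
def XF {X : Type v} (𝒞 : Set (X → L)) : Set (cpT 𝒞) :=
  fcl (cpStruct 𝒞) (Theta 𝒞)

/-- `X^F` as a type. -/
abbrev XFT {X : Type v} (𝒞 : Set (X → L)) : Type _ :=
  {K : cpT 𝒞 // K ∈ XF 𝒞}

/-- The restriction `φ(A)|_{X^F}`. -/
def phiF {X : Type v} (𝒞 : Set (X → L)) (A : X → L) : XFT 𝒞 → L :=
  fun K => fsub K.1.1 A

/-- The convex structure `{φ(A)|_{X^F} | A ∈ 𝒞}` on `X^F`. -/
def xfStruct {X : Type v} (𝒞 : Set (X → L)) : Set (XFT 𝒞 → L) :=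
  {Φ | ∃ A ∈ 𝒞, Φ = phiF 𝒞 A}

/-- The specialization `L`-order of an `L`-convex space. -/
def specOrd {X : Type v} (𝒞 : Set (X → L)) (x y : X) : L :=
  ⨅ A ∈ 𝒞, himp (A y) (A x)

/-! ### basic lemmas -/

lemma single_apply_self {X : Type v} (x : X) : (single x : X → L) x = ⊤ := by
  simp [single, chi]

lemma le_hull {X : Type v} (𝒞 : Set (X → L)) (A : X → L) : A ≤ hull 𝒞 A :=
  le_sInf fun B hB => hB.2

lemma hull_mem {X : Type v} {𝒞 : Set (X → L)} (hC : IsConvexStruct 𝒞)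
    (A : X → L) : hull 𝒞 A ∈ 𝒞 :=
  hC.2.2.2.1 _ fun B hB => hB.1

lemma fsub_anti_left {X : Type v} {A B : X → L} (C : X → L) (h : A ≤ B) :
    fsub B C ≤ fsub A C :=
  le_iInf fun x => le_trans (iInf_le _ x) (himp_le_himp_left _ (h x))

lemma fsub_mono_right {X : Type v} (A : X → L) {B C : X → L} (h : B ≤ C) :
    fsub A B ≤ fsub A C :=
  le_iInf fun x => le_trans (iInf_le _ x) (himp_le_himp_right _ (h x))

lemma fsub_single {X : Type v} (x : X) (C : X → L) :
    fsub (single x) C = C x := by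
  apply le_antisymm
  · refine le_trans (iInf_le _ x) ?_
    rw [single_apply_self, top_himp]
  · apply le_iInf
    intro y
    by_cases h : y = x
    · subst h
      rw [single_apply_self, top_himp]
    · have hy : (single x : X → L) y = ⊥ := by simp [single, chi, h]
      rw [hy, bot_himp]
      exact le_top

lemma sSup_apply_mem {X : Type v} (D : Set (X → L)) (x : X) :
    sSup D x = ⨆ A ∈ D, A x := by
  rw [sSup_apply]
  apply le_antisymm
  · exact iSup_le fun f => le_biSup (fun A => A x) f.2
  · exact iSup₂_le fun A hA => le_iSup_of_le ⟨A, hA⟩ le_rfl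

lemma fsub_hull {X : Type v} {𝒞 : Set (X → L)} (hC : IsConvexStruct 𝒞)
    (A : X → L) {B : X → L} (hB : B ∈ 𝒞) :
    fsub (hull 𝒞 A) B = fsub A B := by
  apply le_antisymm
  · exact fsub_anti_left _ (le_hull 𝒞 A)
  · set s := fsub A B with hs
    have hmem : (fun x => himp s (B x)) ∈ 𝒞 := hC.2.2.2.2 s B hB
    have hA : A ≤ fun x => himp s (B x) := by
      intro x
      have h1 : s ≤ himp (A x) (B x) := iInf_le _ x
      have h2 : tens s (A x) ≤ B x := le_himp_iff.mp h1
      have h3 : tens (A x) s ≤ B x := by rwa [tens_comm]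
      exact le_himp_iff.mpr h3
    have hle : hull 𝒞 A ≤ fun x => himp s (B x) := sInf_le ⟨hmem, hA⟩
    apply le_iInf
    intro x
    have h5 : tens (hull 𝒞 A x) s ≤ B x := le_himp_iff.mp (hle x)
    have h4 : tens s (hull 𝒞 A x) ≤ B x := by rwa [tens_comm]
    exact le_himp_iff.mpr h4

lemma hull_single_compact {X : Type v} {𝒞 : Set (X → L)}
    (hC : IsConvexStruct 𝒞) (x : X) :
    IsCompactConvex 𝒞 (hull 𝒞 (single x)) := by
  refine ⟨hull_mem hC _, ?_, ?_⟩
  · apply le_antisymm le_top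
    calc (⊤ : L) = single x x := (single_apply_self x).symm
      _ ≤ hull 𝒞 (single x) x := le_hull 𝒞 _ x
      _ ≤ ⨆ y, hull 𝒞 (single x) y := le_iSup _ x
  · intro D hD hne hdir
    rw [fsub_hull hC _ (hC.2.2.1 D hD hne hdir), fsub_single, sSup_apply_mem]
    apply le_antisymm
    · refine iSup₂_le fun A hA => ?_
      have : fsub (hull 𝒞 (single x)) A = A x := by
        rw [fsub_hull hC _ (hD hA), fsub_single]
      exact le_trans (le_of_eq this.symm) (le_biSup _ hA)
    · refine iSup₂_le fun A hA => ?_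
      have : fsub (hull 𝒞 (single x)) A = A x := by
        rw [fsub_hull hC _ (hD hA), fsub_single]
      rw [this]
      exact le_biSup (fun A => A x) hA

/-- `Θ(X) ⊆ X^F`. -/
lemma Theta_subset_XF {X : Type v} (𝒞 : Set (X → L)) : Theta 𝒞 ⊆ XF 𝒞 :=
  fun K hK => Set.mem_sInter.mpr fun _ hA => hA.2 hK

/-- The canonical map `ξ_X : X → X^F`, `ξ_X(x) = co(1ₓ)`. -/
noncomputable def xi {X : Type v} {𝒞 : Set (X → L)} (hC : IsConvexStruct 𝒞)
    (x : X) : XFT 𝒞 :=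
  ⟨⟨hull 𝒞 (single x), hull_single_compact hC x⟩, Theta_subset_XF 𝒞 ⟨x, rfl⟩⟩

/-! ### L-orders -/

/-- An `L`-order. -/
structure IsLOrder {P : Type v} (e : P → P → L) : Prop where
  refl : ∀ x, e x x = ⊤
  trans : ∀ x y z, tens (e x y) (e y z) ≤ e x z
  antisymm : ∀ x y, e x y ⊓ e y x = ⊤ → x = y

/-- Lower `L`-subsets. -/
def LowerL {P : Type v} (e : P → P → L) (S : P → L) : Prop :=
  ∀ x y, tens (S x) (e y x) ≤ S y

/-- `s` is the supremum of the `L`-subset `A`. -/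
def IsSupL {P : Type v} (e : P → P → L) (A : P → L) (s : P) : Prop :=
  ∀ y, e s y = fsub A (fun z => e z y)

/-- Scott convex `L`-subsets. -/
def ScottConvex {P : Type v} (e : P → P → L) (A : P → L) : Prop :=
  LowerL e A ∧
  ∀ F : P → L, NonemptyL F → FinL F → ∀ s, IsSupL e F s → fsub F A ≤ A s

/-- The Scott `L`-convex structure `σ*(P)`. -/
def scottStruct {P : Type v} (e : P → P → L) : Set (P → L) :=
  {A | ScottConvex e A}

/-- `L`-join-semilattices. -/
def LJoinSemilat {P : Type v} (e : P → P → L) : Prop :=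
  ∀ F : P → L, NonemptyL F → FinL F → ∃ s, IsSupL e F s

/-- `L`-order-preserving maps. -/
def OrdPres {P : Type v} {Q : Type w} (eP : P → P → L) (eQ : Q → Q → L)
    (f : P → Q) : Prop :=
  ∀ x y, eP x y ≤ eQ (f x) (f y)

/-- Scott convexity-preserving maps. -/
def ScottCP {P : Type v} {Q : Type w} (eP : P → P → L) (eQ : Q → Q → L)
    (f : P → Q) : Prop :=
  OrdPres eP eQ f ∧
  ∀ F : P → L, NonemptyL F → FinL F →
    ∀ s, IsSupL eP F s → IsSupL eQ (zimg f F) (f s)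

/-- Sobrification of an `L`-convex space. -/
def IsSobrification {X : Type v} {Y : Type w} (𝒞X : Set (X → L))
    (𝒞Y : Set (Y → L)) (j : X → Y) : Prop :=
  IsConvexStruct 𝒞Y ∧ Sober 𝒞Y ∧ ConvPres 𝒞X 𝒞Y j ∧
  ∀ (Z : Type u') (𝒞Z : Set (Z → L)), IsConvexStruct 𝒞Z → Sober 𝒞Z →
    ∀ f : X → Z, ConvPres 𝒞X 𝒞Z f →
      ∃! g : Y → Z, ConvPres 𝒞Y 𝒞Z g ∧ f = g ∘ j

/-- `L`-join-semilattice completion. -/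
def IsLJSCompletion {P : Type v} {Q : Type w} (eP : P → P → L)
    (eQ : Q → Q → L) (j : P → Q) : Prop :=
  IsLOrder eQ ∧ LJoinSemilat eQ ∧ ScottCP eP eQ j ∧
  ∀ (M : Type u') (eM : M → M → L), IsLOrder eM → LJoinSemilat eM →
    ∀ f : P → M, ScottCP eP eM f →
      ∃! g : Q → M, ScottCP eQ eM g ∧ f = g ∘ j

/-- `σ*(P)` is an `L`-convex structure. -/
lemma scottStruct_isConvexStruct {P : Type v} (e : P → P → L) :
    IsConvexStruct (scottStruct e) := by
  refine ⟨⟨?_, ?_⟩, ⟨?_, ?_⟩, ?_, ?_, ?_⟩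
  · intro x y
    rw [tens_comm, tens_bot]
  · intro F hF _ s _
    have h1 : fsub F (fun _ => (⊥ : L)) = himp (⨆ x, F x) ⊥ := by
      rw [himp_iSup_left]; rfl
    rw [h1, hF, top_himp]
  · intro x y
    exact le_top
  · intro F _ _ s _
    exact le_top
  · -- directed joins
    intro D hD hne hdir
    constructor
    · intro x y
      apply le_himp_iff.mp
      rw [sSup_apply_mem]
      refine iSup₂_le fun A hA => le_himp_iff.mpr ?_
      exact le_trans ((hD hA).1 x y) (by rw [sSup_apply_mem]; exact le_biSup (fun A => A y) hA)
    · intro F hF hFin s hs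
      rw [hFin D hne hdir, sSup_apply_mem]
      exact iSup₂_le fun A hA =>
        le_trans ((hD hA).2 F hF hFin s hs) (le_biSup (fun A => A s) hA)
  · -- arbitrary meets
    intro D hD
    constructor
    · intro x y
      rw [sInf_apply, sInf_apply]
      apply le_iInf
      intro A
      exact le_trans (tens_mono_left _ (iInf_le _ A)) ((hD A.2).1 x y)
    · intro F hF hFin s hs
      rw [sInf_apply]
      apply le_iInf
      intro A
      refine le_trans (fsub_mono_right F ?_) ((hD A.2).2 F hF hFin s hs)
      intro x
      rw [sInf_apply]
      exact iInf_le _ A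
  · -- himp closure
    intro a C hC
    constructor
    · intro x y
      apply le_himp_iff.mpr
      have h1 : tens (tens (himp a (C x)) (e y x)) a
          = tens (tens (himp a (C x)) a) (e y x) := by
        rw [tens_assoc, tens_comm (e y x) a, ← tens_assoc]
      rw [h1]
      exact le_trans (tens_mono_left _ (tens_himp_le a (C x))) (hC.1 x y)
    · intro F hF hFin s hs
      apply le_himp_iff.mpr
      refine le_trans ?_ (hC.2 F hF hFin s hs)
      apply le_iInf
      intro x
      apply le_himp_iff.mpr
      have h1 : tens (tens (fsub F (fun x => himp a (C x))) a) (F x)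
          = tens (tens (fsub F (fun x => himp a (C x))) (F x)) a := by
        rw [tens_assoc, tens_comm a (F x), ← tens_assoc]
      rw [h1]
      have h2 : tens (fsub F (fun x => himp a (C x))) (F x) ≤ himp a (C x) :=
        le_trans (tens_mono_left _ (iInf_le _ x)) (tens_himp_le _ _)
      exact le_trans (tens_mono_left _ h2) (tens_himp_le a (C x))

end CRL

namespace CRL

/-- Fuzzy inclusion is transitive. -/
lemma tens_fsub_le {L : Type u} [CRL L] {X : Type v} (A B C : X → L) :
    tens (fsub A B) (fsub B C) ≤ fsub A C := by
  refine le_iInf fun x => le_himp_iff.mpr ?_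
  calc tens (tens (fsub A B) (fsub B C)) (A x)
      = tens (tens (fsub A B) (A x)) (fsub B C) := by
        rw [tens_assoc, tens_comm (fsub B C), ← tens_assoc]
    _ ≤ tens (B x) (fsub B C) :=
        tens_mono_left _ (le_himp_iff.mp (iInf_le _ x))
    _ = tens (fsub B C) (B x) := tens_comm _ _
    _ ≤ C x := le_himp_iff.mp (iInf_le _ x)

end CRL

open CRL in
/-- `sub_X(A,B) = sub_{cp(C(X))}(φ(A), φ(B))` for convex `A, B`. -/
theorem stmt_2 {L : Type u} [CRL L] {X : Type v} {𝒞 : Set (X → L)}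
    (hC : IsConvexStruct 𝒞) :
    ∀ A ∈ 𝒞, ∀ B ∈ 𝒞, fsub A B = fsub (phi 𝒞 A) (phi 𝒞 B) := by
  intro A hA B hB
  apply le_antisymm
  · refine le_iInf fun K => le_himp_iff.mpr ?_
    rw [tens_comm]
    exact tens_fsub_le K.1 A B
  · refine le_iInf fun x => ?_
    calc fsub (phi 𝒞 A) (phi 𝒞 B)
        ≤ himp (fsub (hull 𝒞 (single x)) A) (fsub (hull 𝒞 (single x)) B) :=
          iInf_le _ (⟨hull 𝒞 (single x), hull_single_compact hC x⟩ : cpT 𝒞)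
      _ = himp (A x) (B x) := by
          rw [fsub_hull hC _ hA, fsub_hull hC _ hB, fsub_single, fsub_single]
end

section
/- For every L-convex space X, the L-convex space Cp(C(X)) — the set cp(C(X)) of compact convex sets of X equipped with the L-convex structure {φ(A) | A ∈ C(X)}, where φ(A)(K) = sub(K,A) — is sober: for every nonempty finite L-subset F of cp(C(X)) there exists a unique compact convex set A₀ such that the hull of F in Cp(C(X)) equals the hull of the characteristic function 1_{A₀}. -/
universe u v w u'

namespace CRL

lemma top_le_himp_iff {L : Type u} [CRL L] {a b : L} : ⊤ ≤ himp a b ↔ a ≤ b := by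
  rw [le_himp_iff, tens_comm, tens_top]

lemma fsub_eq_top_iff {L : Type u} [CRL L] {X : Type v} {A B : X → L} :
    fsub A B = ⊤ ↔ A ≤ B := by
  rw [fsub, iInf_eq_top]
  exact forall_congr' fun x => by rw [← top_le_iff, top_le_himp_iff]

lemma himp_tens {L : Type u} [CRL L] (a b c : L) :
    himp (tens a b) c = himp a (himp b c) := by
  refine eq_of_forall_le_iff fun d => ?_
  rw [le_himp_iff, le_himp_iff, le_himp_iff, tens_assoc]

lemma himp_iInf {L : Type u} [CRL L] {ι : Sort w} (a : L) (f : ι → L) :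
    himp a (⨅ i, f i) = ⨅ i, himp a (f i) := by
  refine eq_of_forall_le_iff fun d => ?_
  simp only [le_himp_iff, le_iInf_iff]

/-- The union of the compact convex sets weighted by an `L`-subset of `cp(𝒞)`. -/
def weightedUnion {L : Type u} [CRL L] {X : Type v} {𝒞 : Set (X → L)}
    (F : cpT 𝒞 → L) : X → L :=
  fun x => ⨆ K : cpT 𝒞, tens (F K) (K.1 x)

lemma fsub_weightedUnion {L : Type u} [CRL L] {X : Type v} {𝒞 : Set (X → L)}
    (F : cpT 𝒞 → L) (B : X → L) :
    fsub (weightedUnion F) B = fsub F (phi 𝒞 B) := by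
  simp only [fsub, weightedUnion, phi, himp_iSup_left, himp_tens, himp_iInf]
  exact iInf_comm

lemma nonemptyL_weightedUnion {L : Type u} [CRL L] {X : Type v} {𝒞 : Set (X → L)}
    {F : cpT 𝒞 → L} (hF : NonemptyL F) : NonemptyL (weightedUnion F) := by
  unfold NonemptyL weightedUnion
  rw [iSup_comm, ← hF]
  refine iSup_congr fun K => ?_
  have hK : (⨆ x, K.1 x) = ⊤ := K.2.2.1
  rw [← tens_iSup, hK, tens_top]

lemma phi_sSup {L : Type u} [CRL L] {X : Type v} {𝒞 D : Set (X → L)} (hD : D ⊆ 𝒞)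
    (hne : D.Nonempty) (hdir : DirectedOn (· ≤ ·) D) :
    phi 𝒞 (sSup D) = sSup (phi 𝒞 '' D) := by
  funext K
  rw [sSup_apply_mem, iSup_image]
  exact K.2.2.2 D hD hne hdir

lemma isCompactConvex_hull_weightedUnion {L : Type u} [CRL L] {X : Type v}
    {𝒞 : Set (X → L)} (hC : IsConvexStruct 𝒞) {F : cpT 𝒞 → L} (hF : NonemptyL F)
    (hFin : FinL F) : IsCompactConvex 𝒞 (hull 𝒞 (weightedUnion F)) := by
  refine ⟨hull_mem hC _, ?_, fun D hD hne hdir => ?_⟩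
  · refine top_le_iff.mp ?_
    rw [← nonemptyL_weightedUnion hF]
    exact iSup_mono (le_hull 𝒞 _)
  · have hdir' : DirectedOn (· ≤ ·) (phi 𝒞 '' D) := by
      rintro _ ⟨A, hA, rfl⟩ _ ⟨B, hB, rfl⟩
      obtain ⟨E, hE, hAE, hBE⟩ := hdir A hA B hB
      exact ⟨_, ⟨E, hE, rfl⟩, fun K => fsub_mono_right K.1 hAE,
        fun K => fsub_mono_right K.1 hBE⟩
    rw [fsub_hull hC _ (hC.2.2.1 D hD hne hdir), fsub_weightedUnion,
      phi_sSup hD hne hdir, hFin _ (hne.image _) hdir', iSup_image]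
    refine iSup_congr fun A => iSup_congr fun hA => ?_
    rw [fsub_hull hC _ (hD hA), fsub_weightedUnion]

lemma single_le_phi_iff {L : Type u} [CRL L] {X : Type v} {𝒞 : Set (X → L)}
    (K : cpT 𝒞) (A : X → L) : single K ≤ phi 𝒞 A ↔ K.1 ≤ A := by
  rw [← fsub_eq_top_iff, fsub_single, phi, fsub_eq_top_iff]

/-- The space `Cp(𝒞)` is `S₀`. -/
lemma s0_cpStruct {L : Type u} [CRL L] {X : Type v} (𝒞 : Set (X → L)) :
    S0 (cpStruct 𝒞) := by
  have key : ∀ K K' : cpT 𝒞,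
      hull (cpStruct 𝒞) (single K) = hull (cpStruct 𝒞) (single K') → K'.1 ≤ K.1 := by
    intro K K' h
    rw [← single_le_phi_iff]
    calc single K' ≤ hull (cpStruct 𝒞) (single K') := le_hull _ _
      _ = hull (cpStruct 𝒞) (single K) := h.symm
      _ ≤ phi 𝒞 K.1 := sInf_le ⟨⟨K.1, K.2.1, rfl⟩, (single_le_phi_iff K K.1).mpr le_rfl⟩
  exact fun K K' h => Subtype.ext (le_antisymm (key K' K h.symm) (key K K' h))

lemma hull_cpStruct_eq_hull_single {L : Type u} [CRL L] {X : Type v}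
    {𝒞 : Set (X → L)} (hC : IsConvexStruct 𝒞) (F : cpT 𝒞 → L) {K : cpT 𝒞}
    (hK : K.1 = hull 𝒞 (weightedUnion F)) :
    hull (cpStruct 𝒞) F = hull (cpStruct 𝒞) (single K) := by
  refine congrArg sInf (Set.ext fun Φ => and_congr_right ?_)
  rintro ⟨A, hA, rfl⟩
  rw [single_le_phi_iff, hK, ← fsub_eq_top_iff, ← fsub_eq_top_iff, fsub_hull hC _ hA,
    fsub_weightedUnion]

end CRL

open CRL in
/-- `Cp(C(X))` is a sober `L`-convex space. -/
theorem stmt_3 {L : Type u} [CRL L] {X : Type v} {𝒞 : Set (X → L)}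
    (hC : IsConvexStruct 𝒞) :
    Sober (cpStruct 𝒞) := by
  intro F hF hFin
  let K : cpT 𝒞 := ⟨_, isCompactConvex_hull_weightedUnion hC hF hFin⟩
  have hK : hull (cpStruct 𝒞) F = hull (cpStruct 𝒞) (single K) :=
    hull_cpStruct_eq_hull_single hC F rfl
  exact ⟨K, hK, fun K' hK' => s0_cpStruct 𝒞 K' K (hK'.symm.trans hK)⟩
end

section
/- Every convexity-preserving map f : X → Y between L-convex spaces is F-continuous: for every F-closed subset B ⊆ Y, the preimage f⁻¹(B) is an F-closed subset of X. -/
universe u v w u'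

namespace CRL

variable {L : Type u} [CRL L]

lemma le_zimg_apply {X : Type v} {Y : Type w} (f : X → Y) (F : X → L) (x : X) :
    F x ≤ zimg f F (f x) :=
  le_biSup F (show x ∈ {z | f z = f x} from rfl)

lemma zimg_le_iff {X : Type v} {Y : Type w} {f : X → Y} {F : X → L} {B : Y → L} :
    zimg f F ≤ B ↔ F ≤ B ∘ f := by
  constructor
  · intro h x
    exact (le_zimg_apply f F x).trans (h (f x))
  · rintro h y
    refine iSup₂_le fun x (hx : f x = y) => ?_
    subst hx
    exact h x

lemma fsub_zimg {X : Type v} {Y : Type w} (f : X → Y) (F : X → L) (B : Y → L) :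
    fsub (zimg f F) B = fsub F (B ∘ f) := by
  apply le_antisymm
  · refine le_iInf fun x => le_trans (iInf_le _ (f x)) (himp_le_himp_left _ ?_)
    exact le_zimg_apply f F x
  · refine le_iInf fun y => ?_
    simp only [zimg, himp_iSup_left]
    refine le_iInf₂ fun x (hx : f x = y) => ?_
    subst hx
    exact iInf_le (fun x => himp (F x) ((B ∘ f) x)) x

lemma NonemptyL.zimg {X : Type v} {Y : Type w} (f : X → Y) {F : X → L} (hF : NonemptyL F) :
    NonemptyL (zimg f F) := by
  refine top_unique (hF.symm.le.trans (iSup_le fun x => ?_))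
  exact (le_zimg_apply f F x).trans (le_iSup (CRL.zimg f F) (f x))

lemma sSup_comp {X : Type v} {Y : Type w} (f : X → Y) (D : Set (Y → L)) :
    sSup D ∘ f = sSup ((· ∘ f) '' D) := by
  funext x
  rw [Function.comp_apply, sSup_apply_mem, sSup_apply_mem, iSup_image]
  rfl

lemma FinL.zimg {X : Type v} {Y : Type w} (f : X → Y) {F : X → L} (hF : FinL F) :
    FinL (zimg f F) := by
  intro D hne hdir
  have hdir' : DirectedOn (· ≤ ·) ((· ∘ f) '' D) := by
    rintro _ ⟨A, hA, rfl⟩ _ ⟨B, hB, rfl⟩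
    obtain ⟨C, hC, hAC, hBC⟩ := hdir A hA B hB
    exact ⟨C ∘ f, ⟨C, hC, rfl⟩, fun x => hAC (f x), fun x => hBC (f x)⟩
  simp only [fsub_zimg]
  rw [sSup_comp, hF _ (hne.image _) hdir', iSup_image]

lemma hull_le_iff {X : Type v} {𝒞 : Set (X → L)} {A B : X → L} (hB : B ∈ 𝒞) :
    hull 𝒞 A ≤ B ↔ A ≤ B :=
  ⟨(le_hull 𝒞 A).trans, fun h => sInf_le ⟨hB, h⟩⟩

lemma single_le_iff {X : Type v} {x : X} {B : X → L} : single x ≤ B ↔ B x = ⊤ := by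
  constructor
  · intro h
    exact top_unique ((single_apply_self x).symm.le.trans (h x))
  · intro h y
    by_cases hy : y = x
    · rw [hy, h]
      exact le_top
    · simp [single, chi, hy]

lemma hull_zimg_eq_hull_single {X : Type v} {Y : Type w} {𝒞X : Set (X → L)}
    {𝒞Y : Set (Y → L)} {f : X → Y} (hf : ConvPres 𝒞X 𝒞Y f) {F : X → L} {x : X}
    (h : hull 𝒞X F = hull 𝒞X (single x)) :
    hull 𝒞Y (zimg f F) = hull 𝒞Y (single (f x)) := by
  refine congrArg sInf (Set.ext fun B => and_congr_right fun hB => ?_)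
  rw [zimg_le_iff, ← hull_le_iff (hf B hB), h, hull_le_iff (hf B hB), single_le_iff,
    single_le_iff, Function.comp_apply]

end CRL

open CRL in
/-- every convexity-preserving map is F-continuous. -/
theorem stmt_5 {L : Type u} [CRL L] {X : Type v} {Y : Type w}
    {𝒞X : Set (X → L)} {𝒞Y : Set (Y → L)}
    (hX : IsConvexStruct 𝒞X) (hY : IsConvexStruct 𝒞Y)
    (f : X → Y) (hf : ConvPres 𝒞X 𝒞Y f) :
    ∀ B : Set Y, FClosed 𝒞Y B → FClosed 𝒞X (f ⁻¹' B) := by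
  intro B hB F hne hfin hle x hx
  exact hB (zimg f F) (hne.zimg f) (hfin.zimg f) (zimg_le_iff.mpr hle) (f x)
    (hull_zimg_eq_hull_single hf hx)
end

section
/- Let X, Y be L-convex spaces with Y satisfying S₀, let f, g : X → Y be convexity-preserving maps, and let Z ⊆ X with f|_Z = g|_Z. Then f and g agree on the F-closure cl_F(Z) of Z. -/
universe u v w u'

namespace CRL

variable {L : Type u} [CRL L]

lemma fsub_eq_of_hull_eq_hull_single {X : Type v} {𝒞 : Set (X → L)}
    (hC : IsConvexStruct 𝒞) {F : X → L} {x : X}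
    (h : hull 𝒞 F = hull 𝒞 (single x)) {B : X → L} (hB : B ∈ 𝒞) :
    fsub F B = B x := by
  rw [← fsub_hull hC F hB, h, fsub_hull hC _ hB, fsub_single]

lemma fsub_congr_of_le_chi {X : Type v} {F : X → L} {A : Set X}
    (hF : F ≤ chi A) {B C : X → L} (h : ∀ x ∈ A, B x = C x) :
    fsub F B = fsub F C := by
  refine iInf_congr fun x => ?_
  by_cases hx : x ∈ A
  · rw [h x hx]
  · have hFx : F x = ⊥ := by
      have hle := hF x
      rw [chi, if_neg hx] at hle
      exact le_bot_iff.mp hle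
    rw [hFx, bot_himp, bot_himp]

lemma hull_single_eq_of_forall_eq {X : Type v} {𝒞 : Set (X → L)} {x y : X}
    (h : ∀ B ∈ 𝒞, B x = B y) : hull 𝒞 (single x) = hull 𝒞 (single y) := by
  refine congrArg sInf (Set.ext fun B => and_congr_right fun hB => ?_)
  rw [single_le_iff, single_le_iff, h B hB]

/-- The equalizer of two convexity-preserving maps into an `S₀` space is F-closed. -/
lemma fClosed_equalizer {X : Type v} {Y : Type w}
    {𝒞X : Set (X → L)} {𝒞Y : Set (Y → L)} (hX : IsConvexStruct 𝒞X)
    (h0 : S0 𝒞Y) {f g : X → Y} (hf : ConvPres 𝒞X 𝒞Y f)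
    (hg : ConvPres 𝒞X 𝒞Y g) : FClosed 𝒞X {x | f x = g x} := by
  intro F _ _ hF x hx
  refine h0 _ _ (hull_single_eq_of_forall_eq fun B hB => ?_)
  have hfg : fsub F (B ∘ f) = fsub F (B ∘ g) :=
    fsub_congr_of_le_chi hF fun z hz => congrArg B hz
  rwa [fsub_eq_of_hull_eq_hull_single hX hx (hf B hB),
    fsub_eq_of_hull_eq_hull_single hX hx (hg B hB)] at hfg

end CRL

open CRL in
/-- two convexity-preserving maps into an `S₀` space agreeing on
`Z` agree on the F-closure of `Z`. -/
theorem stmt_6 {L : Type u} [CRL L] {X : Type v} {Y : Type w}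
    {𝒞X : Set (X → L)} {𝒞Y : Set (Y → L)}
    (hX : IsConvexStruct 𝒞X) (hY : IsConvexStruct 𝒞Y) (h0 : S0 𝒞Y)
    (f g : X → Y) (hf : ConvPres 𝒞X 𝒞Y f) (hg : ConvPres 𝒞X 𝒞Y g)
    (Z : Set X) (hfg : ∀ z ∈ Z, f z = g z) :
    ∀ x ∈ fcl 𝒞X Z, f x = g x := by
  intro x hx
  exact Set.mem_sInter.mp hx _ ⟨fClosed_equalizer hX h0 hf hg, hfg⟩
end

section
/- Let X be an L-convex space and define ξ_X : X → X^F by ξ_X(x) = co(1_x). Then ξ_X is convexity-preserving; in fact ξ_X^←(φ(A)|_{X^F}) = A for every convex set A of X, where φ(A)(K) = sub(K,A). -/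
universe u v w u'

/-- The preimage of `φ(A)|_{X^F}` under `ξ_X` is `A`. -/
lemma CRL.phiF_comp_xi {L : Type u} [CRL L] {X : Type v} {𝒞 : Set (X → L)}
    (hC : IsConvexStruct 𝒞) {A : X → L} (hA : A ∈ 𝒞) : phiF 𝒞 A ∘ xi hC = A :=
  funext fun x => (fsub_hull hC (single x) hA).trans (fsub_single x A)

open CRL in
/-- `ξ_X : X → X^F` is convexity-preserving, and
`ξ_X^←(φ(A)|_{X^F}) = A` for every convex set `A`. -/
theorem stmt_8 {L : Type u} [CRL L] {X : Type v} {𝒞 : Set (X → L)}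
    (hC : IsConvexStruct 𝒞) :
    ConvPres 𝒞 (xfStruct 𝒞) (xi hC) ∧
    ∀ A ∈ 𝒞, (phiF 𝒞 A) ∘ (xi hC) = A := by
  refine ⟨?_, fun A hA => phiF_comp_xi hC hA⟩
  rintro _ ⟨A, hA, rfl⟩
  rwa [phiF_comp_xi hC hA]
end
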